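/- arXiv:1803.04852 — 2 statements merged into one kernel-verified Lean document; each statement's English description precedes it below -/
import Mathlib

section
/- Let d ≥ 1 and let S ⊆ ℝ^d be a d-dimensional lattice simplex whose interior contains exactly one point x of ℤ^d, and let β_0, β_1, …, β_d > 0 be the barycentric coordinates of x with respect to S. If β_0 · β_1 ⋯ β_d = 1/(s_{d+1} − 1)^2, then there exists a unimodular transformation φ of ℝ^d with φ(S) = T_d. -/
open MeasureTheory ENNReal

noncomputable section

/-- Auxiliary recursion for the Sylvester sequence: `s_{i+1} = s_i (s_i - 1) + 1`,
which is equivalent to `s_i = 1 + s_1 ⋯ s_{i-1}` with `s_1 = 2`. -/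
def sylAux : ℕ → ℕ
  | 0 => 2
  | n + 1 => sylAux n * (sylAux n - 1) + 1

/-- The Sylvester sequence `s_1 = 2`, `s_i = 1 + s_1 s_2 ⋯ s_{i-1}` (1-indexed). -/
def syl (n : ℕ) : ℕ := sylAux (n - 1)

/-- The standard basis vector `e_i` of `ℝ^d`. -/
def stdBasis (d : ℕ) (i : Fin d) : Fin d → ℝ := Pi.single i 1

/-- The integer lattice `ℤ^d`, viewed as a subset of `ℝ^d`. -/
def latticePts (d : ℕ) : Set (Fin d → ℝ) :=
  Set.range fun z : Fin d → ℤ => fun i => (z i : ℝ)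

/-- The simplex `T_d = conv(0, s_1 e_1, …, s_d e_d)`. -/
def Td (d : ℕ) : Set (Fin d → ℝ) :=
  convexHull ℝ (insert 0 (Set.range fun i : Fin d => (syl (i.1 + 1) : ℝ) • stdBasis d i))

lemma mink {ι : Type*} [Fintype ι] [DecidableEq ι] (A : Matrix ι ι ℝ) (hA : A.det ≠ 0)
    (c : ι → ℝ) (hc : ∀ i, 0 < c i) (h : |A.det| < ∏ i, c i) :
    ∃ z : ι → ℤ, z ≠ 0 ∧ ∀ i, |(A.mulVec (fun j => (z j : ℝ))) i| < c i := by
  classical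
  let s : Set (ι → ℝ) := (Matrix.toLin' A) ⁻¹' (Set.pi Set.univ fun i => Set.Ioo (-(c i)) (c i))
  have hdet : LinearMap.det (Matrix.toLin' A) ≠ 0 := by
    rwa [LinearMap.det_toLin']
  have hvol : volume s = ENNReal.ofReal (|A.det|⁻¹ * (2 ^ Fintype.card ι * ∏ i, c i)) := by
    simp only [s]
    rw [Measure.addHaar_preimage_linearMap volume hdet, Real.volume_pi_Ioo, LinearMap.det_toLin',
      ← ENNReal.ofReal_prod_of_nonneg (fun i _ => by linarith [hc i]),
      ← ENNReal.ofReal_mul (abs_nonneg _), abs_inv]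
    congr 2
    rw [show (2:ℝ) ^ Fintype.card ι = ∏ i : ι, (2:ℝ) by simp, ← Finset.prod_mul_distrib]
    exact Finset.prod_congr rfl fun i _ => by ring
  have fund := ZSpan.isAddFundamentalDomain' (Pi.basisFun ℝ ι) volume
  have hF : volume (ZSpan.fundamentalDomain (Pi.basisFun ℝ ι)) = 1 := by
    rw [ZSpan.fundamentalDomain_pi_basisFun, volume_pi, Measure.pi_pi]; simp
  have : Countable (Submodule.span ℤ (Set.range (Pi.basisFun ℝ ι))) := inferInstance
  have : Countable (Submodule.span ℤ (Set.range (Pi.basisFun ℝ ι))).toAddSubgroup := this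
  have h1 : ∀ x ∈ s, -x ∈ s := by
    intro y hy
    simp only [s, Set.mem_preimage, Set.mem_pi, Set.mem_univ, forall_true_left, Set.mem_Ioo,
        map_neg, Pi.neg_apply] at hy ⊢
    intro i
    constructor <;> linarith [(hy i).1, (hy i).2]
  have h2 : Convex ℝ s := by
    exact (convex_pi fun i _ => convex_Ioo _ _).linear_preimage _
  have h3 : volume (ZSpan.fundamentalDomain (Pi.basisFun ℝ ι)) * 2 ^ Module.finrank ℝ (ι → ℝ)
      < volume s := by
    rw [hF, hvol, one_mul, Module.finrank_fintype_fun_eq_card,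
      show (2:ENNReal) ^ Fintype.card ι = ENNReal.ofReal (2 ^ Fintype.card ι) by
        rw [ENNReal.ofReal_pow (by norm_num)]; simp]
    have hp : 0 < |A.det| := abs_pos.2 hA
    rw [ENNReal.ofReal_lt_ofReal_iff_of_nonneg (by positivity)]
    rw [inv_mul_eq_div, lt_div_iff₀ hp]
    exact mul_lt_mul_of_pos_left h (by positivity)
  obtain ⟨x, hx0, hxs⟩ := exists_ne_zero_mem_lattice_of_measure_mul_two_pow_lt_measure
    fund h1 h2 h3
  have hm : (x : ι → ℝ) ∈ Submodule.span ℤ (Set.range (Pi.basisFun ℝ ι)) := x.2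
  rw [Module.Basis.mem_span_iff_repr_mem] at hm
  choose z hz using hm
  have hzx : (fun j => (z j : ℝ)) = (x : ι → ℝ) := by
    funext j; simpa using hz j
  refine ⟨z, ?_, ?_⟩
  · rintro rfl
    apply hx0
    ext j
    rw [← hzx]; simp
  · intro i
    rw [hzx, abs_lt]
    have := hxs
    simp only [s, Set.mem_preimage, Set.mem_pi, Set.mem_univ, forall_true_left, Set.mem_Ioo,
      Matrix.toLin'_apply] at this
    exact this i

lemma forms {ι : Type*} [Fintype ι] [DecidableEq ι] (b : ι → ℝ) (hb : ∀ i, 0 < b i)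
    (h1 : ∑ i, b i < 1) (h : 1 - ∑ i, b i < ∏ i, b i) :
    ∃ z : ι → ℤ, z ≠ 0 ∧ ∀ i, |b i * (∑ j, (z j : ℝ)) - z i| < b i := by
  have hd : (1 - Matrix.vecMulVec b (fun _ => (1:ℝ))).det = 1 - ∑ i, b i := by
    have := Matrix.det_one_add_replicateCol_mul_replicateRow (ι := Unit) (-b) (fun _ : ι => (1:ℝ))
    rw [← Matrix.vecMulVec_eq, Matrix.neg_vecMulVec, ← sub_eq_add_neg] at this
    rw [this]
    simp [dotProduct, sub_eq_add_neg]
  obtain ⟨z, hz, hz'⟩ := mink (1 - Matrix.vecMulVec b (fun _ => (1:ℝ))) (by rw [hd]; linarith) b hb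
    (by rw [hd, abs_of_pos (by linarith)]; exact h)
  refine ⟨z, hz, fun i => ?_⟩
  have := hz' i
  rw [Matrix.sub_mulVec, Matrix.one_mulVec, Pi.sub_apply, abs_sub_comm] at this
  convert this using 3
  simp [Matrix.mulVec, dotProduct, Matrix.vecMulVec_apply, Finset.mul_sum]

lemma abel (x l : ℕ → ℝ) (n : ℕ) (hx : ∀ i < n, x (i+1) ≤ x i)
    (hl : ∀ k ≤ n, 0 ≤ ∑ i ∈ Finset.range k, l i) :
    x n * ∑ i ∈ Finset.range (n+1), l i ≤ ∑ i ∈ Finset.range (n+1), x i * l i := by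
  induction n with
  | zero => simp
  | succ n ih =>
    have h1 := ih (fun i hi => hx i (by omega)) (fun k hk => hl k (by omega))
    have h2 := hl (n+1) le_rfl
    have h3 := hx n (by omega)
    rw [Finset.sum_range_succ _ (n+1), Finset.sum_range_succ (fun i => x i * l i) (n+1)]
    nlinarith

lemma soundA (n : ℕ) (x y : ℕ → ℝ) (hx : ∀ i < n, 0 < x i) (hy : ∀ i < n, 0 < y i)
    (hanti : ∀ i, i + 1 < n → x (i+1) ≤ x i)
    (hp : ∀ k ≤ n, ∏ i ∈ Finset.range k, x i ≤ ∏ i ∈ Finset.range k, y i)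
    (hs : ∑ i ∈ Finset.range n, y i ≤ ∑ i ∈ Finset.range n, x i) : ∀ i < n, x i = y i := by
  rcases n with _ | n
  · intro i hi; omega
  have hl : ∀ k ≤ n + 1, 0 ≤ ∑ i ∈ Finset.range k, Real.log (y i / x i) := by
    intro k hk
    have hxk : 0 < ∏ i ∈ Finset.range k, x i :=
      Finset.prod_pos fun i hi => hx i (by have := Finset.mem_range.1 hi; omega)
    rw [← Real.log_prod]
    · apply Real.log_nonneg
      rw [Finset.prod_div_distrib, one_le_div hxk]
      exact hp k hk
    · intro i hi
      have := Finset.mem_range.1 hi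
      exact (div_pos (hy i (by omega)) (hx i (by omega))).ne'
  have h1 := abel x (fun i => Real.log (y i / x i)) n (fun i hi => hanti i (by omega))
    (fun k hk => hl k (by omega))
  have h2 : 0 ≤ ∑ i ∈ Finset.range (n+1), x i * Real.log (y i / x i) :=
    le_trans (mul_nonneg (hx n (by omega)).le (hl _ le_rfl)) h1
  have h3 : ∀ i ∈ Finset.range (n+1), 0 ≤ y i - x i - x i * Real.log (y i / x i) := by
    intro i hi
    have hi := Finset.mem_range.1 hi
    have h := Real.log_le_sub_one_of_pos (div_pos (hy i hi) (hx i hi))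
    have h' := mul_le_mul_of_nonneg_left h (hx i hi).le
    rw [mul_sub, mul_div_cancel₀ _ (hx i hi).ne'] at h'
    linarith
  have h4 : ∑ i ∈ Finset.range (n+1), (y i - x i - x i * Real.log (y i / x i)) = 0 := by
    apply le_antisymm _ (Finset.sum_nonneg h3)
    rw [Finset.sum_sub_distrib, Finset.sum_sub_distrib]
    linarith
  intro i hi
  have h5 := (Finset.sum_eq_zero_iff_of_nonneg h3).1 h4 i (Finset.mem_range.2 hi)
  by_contra hne
  have hr : y i / x i ≠ 1 := by
    intro h; rw [div_eq_one_iff_eq (hx i hi).ne'] at h; exact hne h.symm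
  have h := Real.log_lt_sub_one_of_pos (div_pos (hy i hi) (hx i hi)) hr
  have h' := mul_lt_mul_of_pos_left h (hx i hi)
  rw [mul_sub, mul_div_cancel₀ _ (hx i hi).ne'] at h'
  linarith

lemma analytic (n : ℕ) (x y : ℕ → ℝ) (hx : ∀ i < n, 0 < x i) (hy : ∀ i < n, 0 < y i)
    (hanti : ∀ i, i + 1 < n → x (i+1) ≤ x i)
    (hxc : ∀ j < n, ∏ i ∈ Finset.range j, x i ≤ ∑ i ∈ Finset.range (n - j), x (j + i))
    (hyc : ∀ j < n, ∏ i ∈ Finset.range j, y i = ∑ i ∈ Finset.range (n - j), y (j + i))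
    (hP : ∏ i ∈ Finset.range n, x i = ∏ i ∈ Finset.range n, y i) : ∀ i < n, x i = y i := by
  have px : ∀ k ≤ n, 0 < ∏ i ∈ Finset.range k, x i := fun k hk =>
    Finset.prod_pos fun i hi => hx i (by have := Finset.mem_range.1 hi; omega)
  have py : ∀ k ≤ n, 0 < ∏ i ∈ Finset.range k, y i := fun k hk =>
    Finset.prod_pos fun i hi => hy i (by have := Finset.mem_range.1 hi; omega)
  have main : ∀ m ≤ n, (∀ k, m ≤ k → k ≤ n →
      ∏ i ∈ Finset.range k, x i = ∏ i ∈ Finset.range k, y i) →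
      ∀ k ≤ n, ∏ i ∈ Finset.range k, x i = ∏ i ∈ Finset.range k, y i := by
    intro m
    induction m using Nat.strong_induction_on with
    | _ m ih =>
      intro hm hC
      rcases Nat.eq_zero_or_pos m with rfl | hm0
      · exact fun k hk => hC k (by omega) hk
      classical
      obtain ⟨j, hj1, hj2, hj3⟩ : ∃ j < m,
          ∏ i ∈ Finset.range j, y i ≤ ∏ i ∈ Finset.range j, x i ∧
          ∀ k, j < k → k < m → ∏ i ∈ Finset.range k, x i < ∏ i ∈ Finset.range k, y i := by
        let Q : ℕ → Prop := fun j => ∏ i ∈ Finset.range j, y i ≤ ∏ i ∈ Finset.range j, x i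
        refine ⟨Nat.findGreatest Q (m-1), ?_, ?_, ?_⟩
        · have := Nat.findGreatest_le (P := Q) (m-1); omega
        · exact Nat.findGreatest_spec (P := Q) (Nat.zero_le (m-1)) (by simp [Q])
        · intro k hk1 hk2
          exact not_le.1 (Nat.findGreatest_is_greatest (P := Q) hk1 (by omega))
      have hle : ∀ k, j ≤ k → k ≤ n → ∏ i ∈ Finset.range k, x i * 1 ≤ 
          ∏ i ∈ Finset.range k, y i ∨ k = j := by
        intro k h1 h2
        rcases eq_or_lt_of_le h1 with h | h
        · right; exact h.symm
        · left
          simp only [mul_one]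
          rcases lt_or_ge k m with h' | h'
          · exact (hj3 k h h').le
          · exact (hC k h' h2).le
      have key := soundA (n - j) (fun i => x (j + i)) (fun i => y (j + i))
        (fun i hi => hx _ (by omega)) (fun i hi => hy _ (by omega))
        (fun i hi => hanti (j + i) (by omega)) ?_ ?_
      · have hPj : ∏ i ∈ Finset.range j, x i = ∏ i ∈ Finset.range j, y i := by
          have e : n = j + (n - j) := by omega
          have hP' := hP
          rw [e, Finset.prod_range_add, Finset.prod_range_add,
            Finset.prod_congr rfl fun i hi => key i (Finset.mem_range.1 hi)] at hP'
          refine mul_right_cancel₀ (ne_of_gt ?_) hP'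
          exact Finset.prod_pos fun i hi => hy _ (by have := Finset.mem_range.1 hi; omega)
        refine ih j hj1 (by omega) fun k hk1 hk2 => ?_
        have e : k = j + (k - j) := by omega
        rw [e, Finset.prod_range_add, Finset.prod_range_add, hPj]
        congr 1
        exact Finset.prod_congr rfl fun i hi =>
          key i (by have := Finset.mem_range.1 hi; omega)
      · intro k hk
        rcases hle (j + k) (by omega) (by omega) with h | h
        · simp only [mul_one] at h
          rw [Finset.prod_range_add, Finset.prod_range_add] at h
          have hpos : 0 < ∏ i ∈ Finset.range k, y (j + i) :=
            Finset.prod_pos fun i hi => hy _ (by have := Finset.mem_range.1 hi; omega)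
          have := px j (by omega)
          refine le_of_mul_le_mul_left (h.trans ?_) this
          exact mul_le_mul_of_nonneg_right hj2 hpos.le
        · have : k = 0 := by omega
          subst this; simp
      · rw [← hyc j (by omega)]
        exact hj2.trans (hxc j (by omega))
  have all := main n le_rfl (fun k h1 h2 => by
    have : k = n := by omega
    rw [this]; exact hP)
  intro i hi
  have h1 := all i (by omega)
  have h2 := all (i+1) (by omega)
  rw [Finset.prod_range_succ, Finset.prod_range_succ, h1] at h2
  exact mul_left_cancel₀ (py i (by omega)).ne' h2

/-- The lattice as an additive subgroup. -/
def latGrp (d : ℕ) : AddSubgroup (Fin d → ℝ) where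
  carrier := latticePts d
  zero_mem' := ⟨0, by ext; simp⟩
  add_mem' := by
    rintro _ _ ⟨a, rfl⟩ ⟨b, rfl⟩
    exact ⟨a + b, by ext; simp⟩
  neg_mem' := by
    rintro _ ⟨a, rfl⟩
    exact ⟨-a, by ext; simp⟩

lemma mem_latGrp {d : ℕ} {x : Fin d → ℝ} : x ∈ latGrp d ↔ x ∈ latticePts d := Iff.rfl

lemma int_smul_mem {d : ℕ} {x : Fin d → ℝ} (h : x ∈ latGrp d) (n : ℤ) :
    (n : ℝ) • x ∈ latGrp d := by
  rw [Int.cast_smul_eq_zsmul]; exact zsmul_mem h n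

lemma prodsum {d : ℕ} {v : Fin (d + 1) → (Fin d → ℝ)} (hvlat : ∀ i, v i ∈ latGrp d)
    {β : Fin (d + 1) → ℝ} (hpos : ∀ i, 0 < β i) (hsum : ∑ i, β i = 1)
    (hx : ∑ i, β i • v i ∈ latGrp d)
    (K : ∀ γ : Fin (d + 1) → ℝ, (∀ i, 0 < γ i) → ∑ i, γ i = 1 → ∑ i, γ i • v i ∈ latGrp d → γ = β)
    (I : Finset (Fin (d + 1))) (i0 : Fin (d + 1)) (hi0 : i0 ∉ I) :
    ∏ i ∈ I, β i ≤ ∑ i ∈ Iᶜ, β i := by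
  classical
  have hsplit := Finset.sum_add_sum_compl I β
  rw [hsum] at hsplit
  have hcpos : 0 < ∑ i ∈ Iᶜ, β i := Finset.sum_pos (fun i _ => hpos i) ⟨i0, by simpa using hi0⟩
  by_contra hlt
  push Not at hlt
  obtain ⟨z, hz, hz'⟩ := forms (fun i : I => β i) (fun i => hpos i)
    (by rw [Finset.sum_coe_sort I β]; linarith)
    (by rw [Finset.sum_coe_sort I β, Finset.prod_coe_sort I β]; linarith)
  have wlog : ∃ z : I → ℤ, z ≠ 0 ∧ (∀ i : I, |β i * (∑ j, (z j : ℝ)) - z i| < β i) ∧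
      0 ≤ ∑ j, z j := by
    rcases le_total 0 (∑ j, z j) with h | h
    · exact ⟨z, hz, hz', h⟩
    · refine ⟨-z, by simpa using hz, fun i => ?_, by simpa using h⟩
      have := hz' i
      rw [← abs_neg] at this
      convert this using 2
      simp only [Pi.neg_apply, Int.cast_neg, Finset.sum_neg_distrib]
      ring
  clear hz hz' z
  obtain ⟨z, hz, hz', hk⟩ := wlog
  let n : Fin (d + 1) → ℤ := fun i => if h : i ∈ I then z ⟨i, h⟩ else 0
  have hnI : ∀ i : I, n i = z i := fun i => by simp [n]
  have hnI' : ∀ i ∉ I, n i = 0 := fun i hi => by simp [n, hi]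
  have hnsum : ∑ i, n i = ∑ j, z j := by
    rw [← Finset.sum_subset (Finset.subset_univ I) (fun i _ hi => hnI' i hi),
      ← Finset.sum_coe_sort I n]
    exact Finset.sum_congr rfl fun i _ => hnI i
  set k : ℤ := ∑ j, z j with hkdef
  have hkR : (∑ j, (z j : ℝ)) = (k : ℝ) := by rw [hkdef]; push_cast; rfl
  have hk0 : (0 : ℝ) ≤ k := by exact_mod_cast hk
  have hnsumR : ∑ i, (n i : ℝ) = k := by exact_mod_cast hnsum
  have key := K (fun i => (k + 1) * β i - n i) ?_ ?_ ?_
  · have h0 := congrFun key i0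
    simp only [hnI' i0 hi0, Int.cast_zero, sub_zero] at h0
    have hkz : (k : ℝ) = 0 := by
      have := (hpos i0).ne'
      have h : (k : ℝ) * β i0 = 0 := by linarith
      exact (mul_eq_zero.1 h).resolve_right this
    apply hz
    funext i
    have h1 := congrFun key i
    simp only [hkz, hnI] at h1
    have : (z i : ℝ) = 0 := by linarith
    exact_mod_cast this
  · intro i
    by_cases hi : i ∈ I
    · have := hz' ⟨i, hi⟩
      rw [hkR, abs_lt] at this
      have h2 := hnI ⟨i, hi⟩
      simp only at h2 this
      rw [h2]
      linarith [this.1]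
    · rw [hnI' i hi]
      have := hpos i
      simp only [Int.cast_zero, sub_zero]
      positivity
  · rw [Finset.sum_sub_distrib, ← Finset.mul_sum, hsum, hnsumR]; ring
  · have : ∑ i, ((k + 1) * β i - n i) • v i =
        ((k + 1 : ℤ) : ℝ) • (∑ i, β i • v i) - ∑ i, (n i : ℝ) • v i := by
      rw [Finset.smul_sum, ← Finset.sum_sub_distrib]
      refine Finset.sum_congr rfl fun i _ => ?_
      rw [sub_smul, mul_smul]; push_cast; rfl
    rw [this]
    exact sub_mem (int_smul_mem hx _) (sum_mem fun i _ => int_smul_mem (hvlat i) _)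

lemma sylAux_ge (n : ℕ) : 2 ≤ sylAux n := by
  induction n with
  | zero => simp [sylAux]
  | succ n ih =>
    rw [sylAux]
    have : 1 ≤ sylAux n * (sylAux n - 1) := Nat.mul_pos (by omega) (by omega)
    omega

lemma sylAux_prod (n : ℕ) : sylAux n = ∏ i ∈ Finset.range n, sylAux i + 1 := by
  induction n with
  | zero => simp [sylAux]
  | succ n ih =>
    rw [sylAux, Finset.prod_range_succ, mul_comm]
    congr 2
    omega

lemma sylAux_coprime_lt {i k : ℕ} (h : i < k) : Nat.Coprime (sylAux i) (sylAux k) := by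
  rw [sylAux_prod k]
  obtain ⟨c, hc⟩ := Finset.dvd_prod_of_mem sylAux (Finset.mem_range.2 h)
  rw [hc]
  simp

lemma sylAux_coprime {i k : ℕ} (h : i ≠ k) : Nat.Coprime (sylAux i) (sylAux k) := by
  rcases lt_or_gt_of_ne h with h | h
  · exact sylAux_coprime_lt h
  · exact (sylAux_coprime_lt h).symm

lemma sylAux_sub_pos (n : ℕ) : (0 : ℝ) < sylAux n - 1 := by
  have : (2 : ℝ) ≤ sylAux n := by exact_mod_cast sylAux_ge n
  linarith

lemma sylAux_prod_inv (n : ℕ) :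
    ∏ i ∈ Finset.range n, (1 / (sylAux i : ℝ)) = 1 / ((sylAux n : ℝ) - 1) := by
  rw [Finset.prod_div_distrib, Finset.prod_const_one]
  congr 1
  have := sylAux_prod n
  rw [this]; push_cast; ring

lemma sylAux_sum_inv (j m : ℕ) :
    ∑ i ∈ Finset.range m, (1 / (sylAux (j + i) : ℝ)) =
      1 / ((sylAux j : ℝ) - 1) - 1 / ((sylAux (j + m) : ℝ) - 1) := by
  induction m with
  | zero => simp
  | succ m ih =>
    rw [Finset.sum_range_succ, ih]
    have e : (sylAux (j + (m + 1)) : ℝ) - 1 = sylAux (j + m) * (sylAux (j + m) - 1) := by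
      have := sylAux_ge (j + m)
      rw [← add_assoc, sylAux]
      push_cast [Nat.cast_sub (show 1 ≤ sylAux (j + m) by omega)]
      ring
    rw [e]
    have h1 := (sylAux_sub_pos (j + m)).ne'
    have h2 := (sylAux_sub_pos j).ne'
    have h3 : (sylAux (j + m) : ℝ) ≠ 0 := by linarith [sylAux_sub_pos (j + m)]
    field_simp
    ring

/-- The extremal sequence. -/
def yseq (d : ℕ) (i : ℕ) : ℝ := if i < d then 1 / (sylAux i : ℝ) else 1 / ((sylAux d : ℝ) - 1)

lemma yseq_pos (d i : ℕ) : 0 < yseq d i := by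
  unfold yseq
  split_ifs
  · have := sylAux_sub_pos i
    have : (0:ℝ) < sylAux i := by linarith
    positivity
  · have := sylAux_sub_pos d
    positivity

lemma yseq_prod (d j : ℕ) (h : j ≤ d) :
    ∏ i ∈ Finset.range j, yseq d i = 1 / ((sylAux j : ℝ) - 1) := by
  rw [← sylAux_prod_inv]
  refine Finset.prod_congr rfl fun i hi => ?_
  have := Finset.mem_range.1 hi
  rw [yseq, if_pos (by omega)]

lemma yseq_sum (d j : ℕ) (h : j ≤ d) :
    ∑ i ∈ Finset.range (d + 1 - j), yseq d (j + i) = 1 / ((sylAux j : ℝ) - 1) := by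
  rw [show d + 1 - j = (d - j) + 1 by omega, Finset.sum_range_succ,
    show j + (d - j) = d by omega]
  have : ∑ i ∈ Finset.range (d - j), yseq d (j + i) =
      ∑ i ∈ Finset.range (d - j), (1 / (sylAux (j + i) : ℝ)) := by
    refine Finset.sum_congr rfl fun i hi => ?_
    have := Finset.mem_range.1 hi
    rw [yseq, if_pos (by omega)]
  rw [this, sylAux_sum_inv, show j + (d - j) = d by omega, yseq, if_neg (by omega)]
  ring

lemma coprime_split {M ι : Type*} [AddCommGroup M] [Fintype ι] [DecidableEq ι]
    (H : AddSubgroup M) (s : ι → ℕ) (hs : ∀ i j, i ≠ j → Nat.Coprime (s i) (s j)) (w : ι → M)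
    (hw : ∀ i, s i • w i ∈ H) (hsum : ∑ i, w i ∈ H) (i : ι) : w i ∈ H := by
  let Q := ∏ k ∈ Finset.univ.erase i, s k
  have hQ : Nat.Coprime (s i) Q :=
    Nat.Coprime.prod_right fun k hk => hs i k (Finset.ne_of_mem_erase hk).symm
  have hQw : Q • w i ∈ H := by
    have e : Q • w i = Q • ∑ k, w k - ∑ k ∈ Finset.univ.erase i, Q • w k := by
      rw [← Finset.add_sum_erase _ w (Finset.mem_univ i), smul_add, Finset.smul_sum]
      abel
    rw [e]
    refine sub_mem (nsmul_mem hsum _) (sum_mem fun k hk => ?_)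
    obtain ⟨c, hc⟩ := Finset.dvd_prod_of_mem s hk
    change (∏ k ∈ Finset.univ.erase i, s k) • w k ∈ H
    rw [hc, mul_comm, mul_smul]
    exact nsmul_mem (hw k) _
  have hb := Nat.isCoprime_iff_coprime.2 hQ
  obtain ⟨a, b, hab⟩ := hb
  have : w i = a • (s i • w i) + b • (Q • w i) := by
    rw [← natCast_zsmul, ← natCast_zsmul, ← mul_smul, ← mul_smul, ← add_smul, hab, one_smul]
  rw [this]
  exact add_mem (zsmul_mem (hw i) _) (zsmul_mem hQw _)

lemma coord_comb {d : ℕ} (b : AffineBasis (Fin (d + 1)) ℝ (Fin d → ℝ)) (γ : Fin (d + 1) → ℝ)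
    (h : ∑ i, γ i = 1) (i : Fin (d + 1)) : b.coord i (∑ j, γ j • b j) = γ i := by
  have := b.coord_apply_combination_of_mem (Finset.mem_univ i) h
  rwa [Finset.affineCombination_eq_linear_combination _ _ _ h] at this

lemma final_geom (d : ℕ) (b : AffineBasis (Fin (d + 1)) ℝ (Fin d → ℝ))
    (hvlat : ∀ i, b i ∈ latGrp d)
    (β : Fin (d + 1) → ℝ) (hsum : ∑ i, β i = 1)
    (hx : ∑ i, β i • b i ∈ latGrp d)
    (K : ∀ γ : Fin (d + 1) → ℝ, (∀ i, 0 < γ i) → ∑ i, γ i = 1 → ∑ i, γ i • b i ∈ latGrp d → γ = β)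
    (hβ : ∀ i : Fin (d + 1), β i = yseq d i) :
    ∃ φ : (Fin d → ℝ) →ᵃ[ℝ] (Fin d → ℝ),
      φ '' latticePts d = latticePts d ∧ φ '' (convexHull ℝ (Set.range b)) = Td d := by
  classical
  let s : Fin d → ℕ := fun i => sylAux i
  have hspos : ∀ i, (0 : ℝ) < s i := fun i => by
    have := sylAux_sub_pos i
    simp only [s]; linarith
  have hβc : ∀ i : Fin d, β i.castSucc = (s i : ℝ)⁻¹ := fun i => by
    rw [hβ, yseq, if_pos (by simp)]; simp [s]
  have hβl : 0 < β (Fin.last d) := by rw [hβ]; exact yseq_pos _ _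
  let L := b (Fin.last d)
  let w : Fin d → (Fin d → ℝ) := fun i => (s i : ℝ)⁻¹ • (b i.castSucc - L)
  -- combination formula
  have comb : ∀ γ : Fin (d + 1) → ℝ, ∑ i, γ i = 1 →
      ∑ i, γ i • b i = L + ∑ i : Fin d, (s i * γ i.castSucc) • w i := by
    intro γ hγ
    rw [Fin.sum_univ_castSucc] at hγ ⊢
    have h1 : γ (Fin.last d) = 1 - ∑ i : Fin d, γ i.castSucc := by linarith
    have h2 : ∀ i : Fin d, (s i * γ i.castSucc) • w i =
        γ i.castSucc • b i.castSucc - γ i.castSucc • L := by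
      intro i
      simp only [w]
      rw [smul_smul, show (s i : ℝ) * γ i.castSucc * (s i : ℝ)⁻¹ = γ i.castSucc by
        have := (hspos i).ne'
        field_simp, smul_sub]
    rw [Finset.sum_congr rfl fun i _ => h2 i, Finset.sum_sub_distrib, h1, sub_smul, one_smul,
      ← Finset.sum_smul]
    simp only [L]
    abel
  have hL : L ∈ latGrp d := hvlat _
  have hw : ∀ i, w i ∈ latGrp d := by
    apply coprime_split (latGrp d) s
    · intro i j hij
      exact sylAux_coprime (fun h => hij (Fin.ext h))
    · intro i
      have : s i • w i = b i.castSucc - L := by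
        simp only [w]
        rw [← Nat.cast_smul_eq_nsmul ℝ, smul_smul, mul_inv_cancel₀ (hspos i).ne', one_smul]
      rw [this]
      exact sub_mem (hvlat _) hL
    · have h := comb β hsum
      have : ∑ i, w i = ∑ i, β i • b i - L := by
        rw [h, add_sub_cancel_left]
        refine Finset.sum_congr rfl fun i _ => ?_
        rw [hβc, mul_inv_cancel₀ (hspos i).ne', one_smul]
      rw [this]
      exact sub_mem hx hL
  let φ : (Fin d → ℝ) →ᵃ[ℝ] (Fin d → ℝ) :=
    AffineMap.pi fun i : Fin d => (s i : ℝ) • b.coord i.castSucc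
  have hφ : ∀ z i, φ z i = s i * b.coord i.castSucc z := fun z i => by simp [φ]
  refine ⟨φ, ?_, ?_⟩
  · apply Set.Subset.antisymm
    · rintro _ ⟨z, hz, rfl⟩
      have hz' : z ∈ latGrp d := hz
      have hzc : z = L + ∑ i : Fin d, (φ z i) • w i := by
        have h1 := b.linear_combination_coord_eq_self z
        have h2 := comb (fun i => b.coord i z) (b.sum_coord_apply_eq_one z)
        rw [h1] at h2
        simp only [hφ]
        exact h2
      let γ : Fin (d + 1) → ℝ := Fin.snoc (α := fun _ => ℝ)
        (fun i : Fin d => (1 - Int.fract (φ z i)) * (s i : ℝ)⁻¹)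
        (β (Fin.last d) + ∑ i : Fin d, Int.fract (φ z i) * (s i : ℝ)⁻¹)
      have hγc : ∀ i : Fin d, γ i.castSucc = (1 - Int.fract (φ z i)) * (s i : ℝ)⁻¹ := by
        intro i; simp [γ]
      have hγl : γ (Fin.last d) =
          β (Fin.last d) + ∑ i : Fin d, Int.fract (φ z i) * (s i : ℝ)⁻¹ := by simp [γ]
      have hγs : ∑ i, γ i = 1 := by
        rw [Fin.sum_univ_castSucc, hγl, ← hsum, Fin.sum_univ_castSucc]
        simp only [hγc, hβc, sub_mul, Finset.sum_sub_distrib, one_mul]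
        ring
      have key := K γ ?_ hγs ?_
      · refine ⟨fun i => ⌊φ z i⌋, ?_⟩
        funext i
        have h := congrFun key i.castSucc
        rw [hγc, hβc] at h
        have hs0 := inv_pos.2 (hspos i)
        have h0 : Int.fract (φ z i) = 0 := by
          have : Int.fract (φ z i) * (s i : ℝ)⁻¹ = 0 := by linarith
          exact (mul_eq_zero.1 this).resolve_right hs0.ne'
        have := Int.floor_add_fract (φ z i)
        simp only
        linarith
      · intro i
        refine Fin.lastCases ?_ (fun i => ?_) i
        · rw [hγl]
          refine add_pos_of_pos_of_nonneg hβl (Finset.sum_nonneg fun i _ => ?_)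
          exact mul_nonneg (Int.fract_nonneg _) (inv_pos.2 (hspos i)).le
        · rw [hγc]
          exact mul_pos (by linarith [Int.fract_lt_one (φ z i)]) (inv_pos.2 (hspos i))
      · rw [comb γ hγs]
        have e : L + ∑ i : Fin d, (s i * γ i.castSucc) • w i =
            (L + ∑ i, w i) - (z - L) + ∑ i : Fin d, ((⌊φ z i⌋ : ℤ) : ℝ) • w i := by
          have : z - L = ∑ i : Fin d, (φ z i) • w i := by
            nth_rewrite 1 [hzc]; rw [add_sub_cancel_left]
          rw [this, add_sub_assoc, add_assoc, ← Finset.sum_sub_distrib, ← Finset.sum_add_distrib]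
          congr 1
          refine Finset.sum_congr rfl fun i _ => ?_
          rw [hγc, mul_comm, mul_assoc, inv_mul_cancel₀ (hspos i).ne', mul_one, Int.fract]
          module
        rw [e]
        exact add_mem (sub_mem (add_mem hL (sum_mem fun i _ => hw i)) (sub_mem hz' hL))
          (sum_mem fun i _ => int_smul_mem (hw i) _)
    · rintro _ ⟨u, rfl⟩
      let γ : Fin (d + 1) → ℝ := Fin.snoc (α := fun _ => ℝ)
        (fun i : Fin d => (u i : ℝ) * (s i : ℝ)⁻¹)
        (1 - ∑ i : Fin d, (u i : ℝ) * (s i : ℝ)⁻¹)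
      have hγc : ∀ i : Fin d, γ i.castSucc = (u i : ℝ) * (s i : ℝ)⁻¹ := by
        intro i; simp [γ]
      have hγl : γ (Fin.last d) = 1 - ∑ i : Fin d, (u i : ℝ) * (s i : ℝ)⁻¹ := by simp [γ]
      have hγs : ∑ i, γ i = 1 := by
        rw [Fin.sum_univ_castSucc, hγl]
        simp only [hγc]
        ring
      have hmul : ∀ i : Fin d, s i * γ i.castSucc = (u i : ℝ) := fun i => by
        rw [hγc, mul_comm, mul_assoc, inv_mul_cancel₀ (hspos i).ne', mul_one]
      refine ⟨∑ i, γ i • b i, ?_, ?_⟩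
      · rw [← mem_latGrp, comb γ hγs]
        refine add_mem hL (sum_mem fun i _ => ?_)
        rw [hmul]
        exact int_smul_mem (hw i) _
      · funext i
        rw [hφ, coord_comb b γ hγs, hmul]
  · rw [AffineMap.image_convexHull, Td]
    congr 1
    have h1 : φ L = 0 := by
      funext i
      rw [hφ, b.coord_apply_ne (Fin.castSucc_lt_last i).ne]; simp
    have h2 : ∀ i : Fin d, φ (b i.castSucc) = (syl (i.1 + 1) : ℝ) • stdBasis d i := by
      intro i
      funext j
      rw [hφ, b.coord_apply]
      by_cases hij : j = i
      · subst hij; simp [stdBasis, syl, s]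
      · simp [stdBasis, hij]
    ext p
    simp only [Set.mem_image, Set.mem_range, Set.mem_insert_iff, exists_exists_eq_and]
    constructor
    · rintro ⟨i, rfl⟩
      refine Fin.lastCases ?_ (fun i => ?_) i
      · left; exact h1
      · right; exact ⟨i, (h2 i).symm⟩
    · rintro (rfl | ⟨i, rfl⟩)
      · exact ⟨Fin.last d, h1⟩
      · exact ⟨i.castSucc, h2 i⟩

/-- Theorem 5 (uniqueness part): if a `d`-dimensional lattice simplex `S` with a unique
interior lattice point `x` has product of barycentric coordinates of `x` equal to
`1/(s_{d+1} - 1)^2`, then there is a unimodular transformation (an affine map `φ` of `ℝ^d`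
with `φ(ℤ^d) = ℤ^d`) mapping `S` onto `T_d`. -/
theorem product_barycentric_coords_equality_case
    (d : ℕ) (hd : 1 ≤ d)
    (v : Fin (d + 1) → (Fin d → ℝ)) (hv : AffineIndependent ℝ v)
    (hvlat : ∀ i, v i ∈ latticePts d)
    (S : Set (Fin d → ℝ)) (hS : S = convexHull ℝ (Set.range v))
    (x : Fin d → ℝ) (hx : latticePts d ∩ interior S = {x})
    (β : Fin (d + 1) → ℝ)
    (hβpos : ∀ i, 0 < β i)
    (hβsum : ∑ i, β i = 1)
    (hβx : x = ∑ i, β i • v i)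
    (heq : ∏ i, β i = 1 / ((syl (d + 1) : ℝ) - 1) ^ 2) :
    ∃ φ : (Fin d → ℝ) →ᵃ[ℝ] (Fin d → ℝ),
      φ '' latticePts d = latticePts d ∧ φ '' S = Td d := by
  classical
  let π : Equiv.Perm (Fin (d + 1)) := Tuple.sort (fun i => -β i)
  have hmono : Monotone ((fun i => -β i) ∘ π) := Tuple.monotone_sort _
  have hv' : AffineIndependent ℝ (v ∘ π) := hv.comp_embedding π.toEmbedding
  let b : AffineBasis (Fin (d + 1)) ℝ (Fin d → ℝ) :=
    ⟨v ∘ π, hv', by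
      rw [hv'.affineSpan_eq_top_iff_card_eq_finrank_add_one]; simp⟩
  have hbv : ∀ i, b i = v (π i) := fun i => rfl
  have hrange : Set.range b = Set.range v := π.surjective.range_comp v
  have hS' : S = convexHull ℝ (Set.range b) := by rw [hrange, hS]
  let β' : Fin (d + 1) → ℝ := fun i => β (π i)
  have hpos' : ∀ i, 0 < β' i := fun i => hβpos _
  have hsum' : ∑ i, β' i = 1 := by rw [← hβsum]; exact Equiv.sum_comp π β
  have hprod' : ∏ i, β' i = ∏ i, β i := Equiv.prod_comp π β
  have hx' : ∑ i, β' i • b i = x := by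
    rw [hβx]; exact Equiv.sum_comp π (fun i => β i • v i)
  have hxlat : x ∈ latGrp d := by
    have : x ∈ latticePts d ∩ interior S := by rw [hx]; rfl
    exact this.1
  have hb : ∀ i, b i ∈ latGrp d := fun i => hvlat _
  have K : ∀ γ : Fin (d + 1) → ℝ, (∀ i, 0 < γ i) → ∑ i, γ i = 1 →
      ∑ i, γ i • b i ∈ latGrp d → γ = β' := by
    intro γ h1 h2 h3
    have : ∑ i, γ i • b i ∈ latticePts d ∩ interior S := by
      refine ⟨h3, ?_⟩
      rw [hS', b.interior_convexHull]
      intro i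
      rw [coord_comb b γ h2]
      exact h1 i
    rw [hx] at this
    have h4 : ∑ i, γ i • b i = x := this
    funext i
    rw [← coord_comb b γ h2 i, h4, ← hx', coord_comb b β' hsum' i]
  rw [← hx'] at hxlat
  have PS := prodsum hb hpos' hsum' hxlat K
  rw [hS']
  refine final_geom d b hb β' hsum' hxlat K ?_
  -- analytic part
  let X : ℕ → ℝ := fun i => if h : i < d + 1 then β' ⟨i, h⟩ else 0
  have hX : ∀ i : Fin (d + 1), X i = β' i := fun i => dif_pos i.2
  have ana := analytic (d + 1) X (yseq d) ?_ (fun i _ => yseq_pos d i) ?_ ?_ ?_ ?_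
  · intro i
    rw [← hX, ana i i.2]
  · intro i hi
    simp only [X, hi, dif_pos]; exact hpos' _
  · intro i hi
    simp only [X, hi, dif_pos, show i < d + 1 by omega]
    have := hmono (show (⟨i, by omega⟩ : Fin (d + 1)) ≤ ⟨i + 1, hi⟩ by
      rw [Fin.le_def]; simp)
    simp only [Function.comp] at this
    exact neg_le_neg_iff.1 this
  · intro j hj
    have h := PS (Finset.univ.filter fun i : Fin (d + 1) => i.1 < j) ⟨j, hj⟩ (by simp)
    have e1 : ∏ i ∈ Finset.univ.filter (fun i : Fin (d + 1) => i.1 < j), β' i =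
        ∏ i ∈ Finset.range j, X i := by
      refine Finset.prod_bij (fun i _ => i.1) ?_ ?_ ?_ ?_
      · intro i hi; simpa using hi
      · intro i _ k _ h; exact Fin.ext h
      · intro k hk
        have := Finset.mem_range.1 hk
        exact ⟨⟨k, by omega⟩, by simpa using this, rfl⟩
      · intro i _; exact (hX i).symm
    have e2 : ∑ i ∈ (Finset.univ.filter (fun i : Fin (d + 1) => i.1 < j))ᶜ, β' i =
        ∑ i ∈ Finset.range (d + 1 - j), X (j + i) := by
      refine Finset.sum_bij (fun i _ => i.1 - j) ?_ ?_ ?_ ?_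
      · intro i hi
        simp at hi
        simp only [Finset.mem_range]
        omega
      · intro i hi k hk h
        simp at hi hk
        apply Fin.ext; omega
      · intro k hk
        have := Finset.mem_range.1 hk
        exact ⟨⟨j + k, by omega⟩, by simp, by simp⟩
      · intro i hi
        simp at hi
        rw [show j + (i.1 - j) = i.1 by omega, hX]
    rw [e1, e2] at h
    exact h
  · intro j hj
    rw [yseq_prod d j (by omega), yseq_sum d j (by omega)]
  · rw [Finset.prod_range_succ (yseq d), yseq_prod d d le_rfl, yseq, if_neg (by omega)]
    rw [Finset.prod_range, Finset.prod_congr rfl fun i _ => hX i, hprod', heq]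
    simp only [syl, Nat.add_sub_cancel]
    rw [sq, one_div_mul_one_div]
end
end

section
/- Let d ≥ 1 be an integer, let Λ be a lattice of rank d in ℝ^d containing the standard basis vectors e_1, …, e_d, let Δ_0 := conv(0, e_1, …, e_d) and Δ := conv(e_1, …, e_d). Assume that Λ ∩ relint(Δ) = {b} for a single point b = (β_1, …, β_d), and let Y := {y = (y_1,…,y_d) ∈ Λ : |y_i| < β_i for all i = 1,…,d}. Then: (i) for every y ∈ Y with y_1 + ⋯ + y_d < 0, the point y + b belongs to Λ ∩ int(Δ_0); and (ii) the only y ∈ Y with y_1 + ⋯ + y_d = 0 is y = 0. -/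
open MeasureTheory ENNReal

noncomputable section

/-- The lattice `M ℤ^d` of rank `d` determined by a nonsingular matrix `M`;
its determinant is `|det M|`. -/
def matLattice {d : ℕ} (M : Matrix (Fin d) (Fin d) ℝ) : Set (Fin d → ℝ) :=
  Set.range fun z : Fin d → ℤ => M.mulVec fun i => (z i : ℝ)

theorem aux_hull (d : ℕ) : convexHull ℝ (Set.range (stdBasis d)) = stdSimplex ℝ (Fin d) := by
  rw [← convexHull_rangle_single_eq_stdSimplex]
  rfl

theorem aux_add {d : ℕ} {M : Matrix (Fin d) (Fin d) ℝ} {x y : Fin d → ℝ}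
    (hx : x ∈ matLattice M) (hy : y ∈ matLattice M) : x + y ∈ matLattice M := by
  obtain ⟨z, rfl⟩ := hx
  obtain ⟨w, rfl⟩ := hy
  refine ⟨z + w, ?_⟩
  simp only [← Matrix.mulVec_add]
  congr 1
  ext i
  simp

theorem aux_span {d : ℕ} {x : Fin d → ℝ} (hx : x ∈ affineSpan ℝ (stdSimplex ℝ (Fin d))) :
    ∑ i, x i = 1 := by
  refine affineSpan_induction (p := fun x => ∑ i, x i = 1) hx (fun y hy => hy.2) ?_
  intro c u v w hu hv hw
  simp only [vsub_eq_sub, vadd_eq_add, Pi.add_apply, Pi.smul_apply, Pi.sub_apply, smul_eq_mul,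
    Finset.sum_add_distrib, ← Finset.mul_sum, Finset.sum_sub_distrib, hu, hv, hw]
  simp

theorem aux_relint {d : ℕ} (x : Fin d → ℝ) :
    x ∈ intrinsicInterior ℝ (stdSimplex ℝ (Fin d)) ↔ (∀ i, 0 < x i) ∧ ∑ i, x i = 1 := by
  constructor
  · intro hx
    refine ⟨fun i => ?_, (intrinsicInterior_subset hx).2⟩
    obtain ⟨a, ha, rfl⟩ := mem_intrinsicInterior.1 hx
    have hmem : ∀ s : ℝ, AffineMap.lineMap (Pi.single i 1 : Fin d → ℝ) (a : Fin d → ℝ) s ∈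
        affineSpan ℝ (stdSimplex ℝ (Fin d)) := fun s =>
      AffineMap.lineMap_mem s (subset_affineSpan ℝ _ (single_mem_stdSimplex ℝ i)) a.2
    let f : ℝ → affineSpan ℝ (stdSimplex ℝ (Fin d)) := fun s => ⟨_, hmem s⟩
    have hf : Continuous f := Continuous.subtype_mk AffineMap.lineMap_continuous _
    have hf1 : f 1 = a := by
      apply Subtype.ext
      simp [f]
    have h1 : ∀ᶠ s in nhds (1 : ℝ), f s ∈ interior
        ((↑) ⁻¹' (stdSimplex ℝ (Fin d)) : Set (affineSpan ℝ (stdSimplex ℝ (Fin d)))) :=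
      hf.continuousAt.eventually_mem (isOpen_interior.mem_nhds (by rw [hf1]; exact ha))
    obtain ⟨s, hs, hs1⟩ := ((h1.filter_mono nhdsWithin_le_nhds).and
      (self_mem_nhdsWithin (s := Set.Ioi (1 : ℝ)))).exists
    have h2 := (interior_subset hs).1 i
    simp only [f, AffineMap.lineMap_apply, vsub_eq_sub, vadd_eq_add, Pi.add_apply, Pi.smul_apply,
      Pi.sub_apply, smul_eq_mul, Pi.single_eq_same] at h2
    have hs1 : 1 < s := hs1
    by_contra hc
    nlinarith
  · rintro ⟨h0, h1⟩
    have hx : x ∈ stdSimplex ℝ (Fin d) := ⟨fun i => (h0 i).le, h1⟩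
    refine mem_intrinsicInterior.2 ⟨⟨x, subset_affineSpan ℝ _ hx⟩, ?_, rfl⟩
    refine mem_interior.2 ⟨{y | ∀ i, 0 < (y : Fin d → ℝ) i}, ?_, ?_, h0⟩
    · intro y hy
      exact ⟨fun i => (hy i).le, aux_span y.2⟩
    · simp only [Set.ofPred_forall]
      exact isOpen_iInter_of_finite fun i => isOpen_lt continuous_const ((continuous_apply i).comp continuous_subtype_val)

theorem aux_int {d : ℕ} (hd : 1 ≤ d) {x : Fin d → ℝ} (h0 : ∀ i, 0 < x i) (h1 : ∑ i, x i < 1) :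
    x ∈ interior (convexHull ℝ (insert 0 (Set.range (stdBasis d)))) := by
  refine mem_interior.2 ⟨{y | (∀ i, 0 < y i) ∧ ∑ i, y i < 1}, ?_, ?_, h0, h1⟩
  · rintro y ⟨hy0, hy1⟩
    have : Nonempty (Fin d) := ⟨⟨0, hd⟩⟩
    have hs : 0 < ∑ i, y i := Finset.sum_pos (fun i _ => hy0 i) Finset.univ_nonempty
    have hz : (∑ i, y i)⁻¹ • y ∈ convexHull ℝ (insert 0 (Set.range (stdBasis d))) := by
      apply convexHull_mono (Set.subset_insert _ _)
      rw [aux_hull]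
      refine ⟨fun i => ?_, ?_⟩
      · have := hy0 i
        simp only [Pi.smul_apply, smul_eq_mul]
        positivity
      · simp only [Pi.smul_apply, smul_eq_mul, ← Finset.mul_sum]
        exact inv_mul_cancel₀ hs.ne'
    have := (convex_convexHull ℝ _).smul_mem_of_zero_mem
      (subset_convexHull ℝ _ (Set.mem_insert _ _)) hz ⟨hs.le, hy1.le⟩
    rwa [smul_inv_smul₀ hs.ne'] at this
  · simp only [Set.ofPred_and, Set.ofPred_forall]
    exact (isOpen_iInter_of_finite fun i => isOpen_lt continuous_const (by fun_prop)).inter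
      (isOpen_lt (by fun_prop) continuous_const)

/-- Inclusions from the proof of Theorem 2: let `Λ` be a lattice of rank `d` containing
`e_1, …, e_d`, let `Δ_0 = conv(0, e_1, …, e_d)`, `Δ = conv(e_1, …, e_d)`, and assume
`Λ ∩ relint Δ = {b}` with `b = (β_1, …, β_d)`. With
`Y = {y ∈ Λ : |y_i| < β_i for all i}`, then: (i) every `y ∈ Y` with `y_1 + ⋯ + y_d < 0`
satisfies `y + b ∈ Λ ∩ int Δ_0`; and (ii) the only `y ∈ Y` with `y_1 + ⋯ + y_d = 0` is
`y = 0`. -/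
theorem Y_halfspace_inclusions
    (d : ℕ) (hd : 1 ≤ d)
    (M : Matrix (Fin d) (Fin d) ℝ) (hM : M.det ≠ 0)
    (hbasis : ∀ i : Fin d, stdBasis d i ∈ matLattice M)
    (b : Fin d → ℝ)
    (hb : matLattice M ∩
        intrinsicInterior ℝ (convexHull ℝ (Set.range (stdBasis d))) = {b}) :
    (∀ y ∈ {y ∈ matLattice M | ∀ i, |y i| < b i}, (∑ i, y i) < 0 →
      y + b ∈ matLattice M ∩
        interior (convexHull ℝ (insert 0 (Set.range (stdBasis d))))) ∧
    {y ∈ {y ∈ matLattice M | ∀ i, |y i| < b i} | (∑ i, y i) = 0} = {0} := by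
  rw [aux_hull] at hb
  have hbm : b ∈ matLattice M ∩ intrinsicInterior ℝ (stdSimplex ℝ (Fin d)) := by
    rw [hb]; rfl
  obtain ⟨hbL, hbi⟩ := hbm
  obtain ⟨hb0, hb1⟩ := (aux_relint b).1 hbi
  have hpos : ∀ y : Fin d → ℝ, (∀ i, |y i| < b i) → ∀ i, 0 < (y + b) i := by
    intro y hy i
    have := (abs_lt.1 (hy i)).1
    simp only [Pi.add_apply]
    linarith
  refine ⟨?_, ?_⟩
  · rintro y ⟨hyL, hy⟩ hs
    refine ⟨aux_add hyL hbL, aux_int hd (hpos y hy) ?_⟩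
    simp only [Pi.add_apply, Finset.sum_add_distrib]
    linarith
  · ext y
    constructor
    · rintro ⟨⟨hyL, hy⟩, hs⟩
      have h : y + b ∈ ({b} : Set (Fin d → ℝ)) := by
        rw [← hb]
        refine ⟨aux_add hyL hbL, (aux_relint _).2 ⟨hpos y hy, ?_⟩⟩
        simp only [Pi.add_apply, Finset.sum_add_distrib]
        linarith
      simpa using h
    · rintro rfl
      refine ⟨⟨⟨0, ?_⟩, ?_⟩, by simp⟩
      · ext i
        simp [Matrix.mulVec, dotProduct]
      · intro i
        simpa using hb0 i
end
end
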